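/- arXiv:2205.08162 — 3 statements merged into one kernel-verified Lean document; each statement's English description precedes it below -/
import Mathlib

section
/- Q-resolvent equation (quaternionic-kernel form): let s, p, q ∈ ℍ with Q_{c,s}(q) ≠ 0, Q_{c,p}(q) ≠ 0 and p ∉ [s] (i.e. Q_s(p) := p² − 2Re(s)p + |s|² ≠ 0). Then s·Q_{c,s}(q)^{−1}·Q_{c,p}(q)^{−1}·p − s·Q_{c,s}(q)^{−1}·q̄·Q_{c,p}(q)^{−1} − Q_{c,s}(q)^{−1}·q̄·Q_{c,p}(q)^{−1}·p + Q_{c,s}(q)^{−1}·q̄²·Q_{c,p}(q)^{−1} = [(s·Q_{c,s}(q)^{−1} − p·Q_{c,p}(q)^{−1})·p − s̄·(s·Q_{c,s}(q)^{−1} − p·Q_{c,p}(q)^{−1})]·Q_s(p)^{−1} + [(q̄·Q_{c,p}(q)^{−1} − Q_{c,s}(q)^{−1}·q̄)·p − s̄·(q̄·Q_{c,p}(q)^{−1} − Q_{c,s}(q)^{−1}·q̄)]·Q_s(p)^{−1}. -/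
noncomputable section

open Quaternion Finset

def e1 : Quaternion ℝ := ⟨0, 1, 0, 0⟩
def e2 : Quaternion ℝ := ⟨0, 0, 1, 0⟩
def e3 : Quaternion ℝ := ⟨0, 0, 0, 1⟩

/-- Left Fueter operator `Df = ∂₀f + e₁∂₁f + e₂∂₂f + e₃∂₃f` (real directional derivatives
along `1, e₁, e₂, e₃`). -/
def fueterL (f : Quaternion ℝ → Quaternion ℝ) (q : Quaternion ℝ) : Quaternion ℝ :=
  fderiv ℝ f q 1 + e1 * fderiv ℝ f q e1 + e2 * fderiv ℝ f q e2 + e3 * fderiv ℝ f q e3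

/-- Right Fueter operator `fD = ∂₀f + (∂₁f)e₁ + (∂₂f)e₂ + (∂₃f)e₃`. -/
def fueterR (f : Quaternion ℝ → Quaternion ℝ) (q : Quaternion ℝ) : Quaternion ℝ :=
  fderiv ℝ f q 1 + fderiv ℝ f q e1 * e1 + fderiv ℝ f q e2 * e2 + fderiv ℝ f q e3 * e3

/-- Second directional derivative along `v`. -/
def dir2 (f : Quaternion ℝ → Quaternion ℝ) (v q : Quaternion ℝ) : Quaternion ℝ :=
  fderiv ℝ (fun x => fderiv ℝ f x v) q v

/-- Laplacian in the four real coordinates of a quaternionic variable. -/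
def quatLaplacian (f : Quaternion ℝ → Quaternion ℝ) (q : Quaternion ℝ) : Quaternion ℝ :=
  dir2 f 1 q + dir2 f e1 q + dir2 f e2 q + dir2 f e3 q

/-- `Q_{c,s}(q) = s² − 2 Re(q) s + |q|²` (commutative pseudo Cauchy kernel denominator). -/
def Qcs (s q : Quaternion ℝ) : Quaternion ℝ :=
  s ^ 2 - 2 * (q.re : Quaternion ℝ) * s + ((‖q‖ ^ 2 : ℝ) : Quaternion ℝ)

/-- Left slice hyperholomorphic Cauchy kernel `S_L⁻¹(s,q) = (s − q̄) Q_{c,s}(q)⁻¹` (form II). -/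
def SL (s q : Quaternion ℝ) : Quaternion ℝ := (s - star q) * (Qcs s q)⁻¹

/-- Right slice hyperholomorphic Cauchy kernel `S_R⁻¹(s,q) = Q_{c,s}(q)⁻¹ (s − q̄)` (form II). -/
def SR (s q : Quaternion ℝ) : Quaternion ℝ := (Qcs s q)⁻¹ * (s - star q)

/-- Left F-kernel `F_L(s,q) = −4 (s − q̄) Q_{c,s}(q)⁻²`. -/
def FL (s q : Quaternion ℝ) : Quaternion ℝ := -4 * (s - star q) * ((Qcs s q) ^ 2)⁻¹

/-- Right F-kernel `F_R(s,q) = −4 Q_{c,s}(q)⁻² (s − q̄)`. -/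
def FR (s q : Quaternion ℝ) : Quaternion ℝ := -4 * ((Qcs s q) ^ 2)⁻¹ * (s - star q)

theorem two_re_mul (q x : Quaternion ℝ) :
    2 * (q.re : Quaternion ℝ) * x = (q + star q) * x := by
  rw [Quaternion.self_add_star]

theorem two_re_mul_comm (q x : Quaternion ℝ) : (q + star q) * x = x * (q + star q) := by
  rw [Quaternion.self_add_star', (Quaternion.coe_commutes _ x)]

theorem coe_norm_sq_eq (q : Quaternion ℝ) :
    ((‖q‖ ^ 2 : ℝ) : Quaternion ℝ) = star q * q := by
  rw [Quaternion.star_mul_self, Quaternion.normSq_eq_norm_mul_self, sq]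

theorem Qcs_eq_left (s q : Quaternion ℝ) :
    Qcs s q = s * (s - star q) - (s - star q) * q := by
  rw [Qcs, two_re_mul, two_re_mul_comm, coe_norm_sq_eq]
  noncomm_ring

theorem Qcs_eq_right (s q : Quaternion ℝ) :
    Qcs s q = (s - star q) * s - q * (s - star q) := by
  rw [Qcs, two_re_mul, coe_norm_sq_eq, Quaternion.star_mul_self, ← Quaternion.self_mul_star]
  noncomm_ring

theorem commute_Qcs (s q : Quaternion ℝ) : Commute s (Qcs s q) := by
  unfold Qcs
  have h : Commute s (2 * (q.re : Quaternion ℝ)) := by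
    have := two_re_mul_comm q s
    rw [Quaternion.self_add_star] at this
    exact this.symm
  exact (((Commute.refl s).pow_right 2).sub_right (h.mul_right (Commute.refl s))).add_right
    (Quaternion.coe_commutes _ s).symm

/-- First-order resolvent identity of the right Cauchy kernel. -/
theorem mul_SR_sub (s q : Quaternion ℝ) (hs : Qcs s q ≠ 0) :
    s * SR s q - SR s q * q = 1 := by
  rw [SR, ← mul_assoc, ((commute_Qcs s q).inv_right₀).eq, mul_assoc, mul_assoc, ← mul_sub,
    ← Qcs_eq_left, inv_mul_cancel₀ hs]

/-- First-order resolvent identity of the left Cauchy kernel. -/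
theorem SL_mul_sub (p q : Quaternion ℝ) (hp : Qcs p q ≠ 0) :
    SL p q * p - q * SL p q = 1 := by
  rw [SL, mul_assoc, ← ((commute_Qcs p q).inv_right₀).eq, ← mul_assoc, ← mul_assoc, ← sub_mul,
    ← Qcs_eq_right, mul_inv_cancel₀ hp]

/-- A solution of `x p - s x = d` satisfies `x Q_s(p) = d p - s̄ d`. -/
theorem mul_Qcs_of_sylvester {s p x d : Quaternion ℝ} (h : x * p = d + s * x) :
    x * Qcs p s = d * p - star s * d := by
  have hx : x * (s + star s) = (s + star s) * x := (two_re_mul_comm s x).symm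
  have hn : x * (star s * s) = star s * s * x := by
    rw [← coe_norm_sq_eq]
    exact (Quaternion.coe_commutes _ x).symm
  calc x * Qcs p s = x * p * p - x * (s + star s) * p + x * (star s * s) := by
        rw [Qcs, two_re_mul, coe_norm_sq_eq]
        noncomm_ring
    _ = (x * p) * p - (s + star s) * (x * p) + star s * s * x := by
        rw [hx, hn, mul_assoc (s + star s)]
    _ = d * p + s * (x * p) - (s + star s) * (x * p) + star s * s * x := by
        nth_rewrite 1 [h]
        noncomm_ring
    _ = d * p - star s * d := by
        rw [h]
        noncomm_ring

/-- The S-resolvent equation for the Cauchy kernels. -/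
theorem SR_mul_SL (s p q : Quaternion ℝ)
    (hs : Qcs s q ≠ 0) (hp : Qcs p q ≠ 0) (hps : Qcs p s ≠ 0) :
    SR s q * SL p q
      = ((SR s q - SL p q) * p - star s * (SR s q - SL p q)) * (Qcs p s)⁻¹ := by
  rw [eq_mul_inv_iff_mul_eq₀ hps]
  apply mul_Qcs_of_sylvester
  calc SR s q * SL p q * p
      = SR s q * (SL p q * p - q * SL p q)
        - (s * SR s q - SR s q * q) * SL p q + s * (SR s q * SL p q) := by noncomm_ring
    _ = SR s q - SL p q + s * (SR s q * SL p q) := by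
        rw [mul_SR_sub s q hs, SL_mul_sub p q hp, mul_one, one_mul]

/-- The Q-resolvent equation in quaternionic-kernel form.  Here
`Q_s(p) = p² − 2Re(s)p + |s|² = Qcs p s`. -/
theorem Qresolvent_equation (s p q : Quaternion ℝ)
    (hs : Qcs s q ≠ 0) (hp : Qcs p q ≠ 0) (hps : Qcs p s ≠ 0) :
    s * (Qcs s q)⁻¹ * (Qcs p q)⁻¹ * p - s * (Qcs s q)⁻¹ * star q * (Qcs p q)⁻¹
      - (Qcs s q)⁻¹ * star q * (Qcs p q)⁻¹ * p + (Qcs s q)⁻¹ * (star q) ^ 2 * (Qcs p q)⁻¹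
    = ((s * (Qcs s q)⁻¹ - p * (Qcs p q)⁻¹) * p
          - star s * (s * (Qcs s q)⁻¹ - p * (Qcs p q)⁻¹)) * (Qcs p s)⁻¹
      + ((star q * (Qcs p q)⁻¹ - (Qcs s q)⁻¹ * star q) * p
          - star s * (star q * (Qcs p q)⁻¹ - (Qcs s q)⁻¹ * star q)) * (Qcs p s)⁻¹ := by
  have hA : s * (Qcs s q)⁻¹ = (Qcs s q)⁻¹ * s := (commute_Qcs s q).inv_right₀.eq
  have hB : p * (Qcs p q)⁻¹ = (Qcs p q)⁻¹ * p := (commute_Qcs p q).inv_right₀.eq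
  have hR : SR s q = s * (Qcs s q)⁻¹ - (Qcs s q)⁻¹ * star q := by rw [SR, mul_sub, hA]
  have hL : SL p q = p * (Qcs p q)⁻¹ - star q * (Qcs p q)⁻¹ := by rw [SL, sub_mul]
  have key := SR_mul_SL s p q hs hp hps
  rw [← add_mul]
  calc _ = SR s q * SL p q := by
        rw [hR, hL, hB]
        simp only [sub_mul, mul_sub, mul_assoc, sq]
        abel
    _ = _ := by
        rw [key, hR, hL]
        congr 1
        noncomm_ring
end
end

section
/- Fueter-polynomial moment formula for the F-kernel (ball version of the contour-integral identity for the F-functional calculus): let q ∈ ℍ, m ∈ ℕ, r > |q| and J ∈ 𝕊, and set s(θ) := r(cos θ + J sin θ). Then −(1/(4π(m+1)(m+2)))·∫₀^{2π} F_L(s(θ), q) · r(cos θ + J sin θ) · s(θ)^{m+2} dθ = ∑_{j=0}^{m} (2(m−j+1)/((m+1)(m+2)))·q^{m−j}·q̄^{j} (the F-kernel is defined for all θ since |s(θ)| = r > |q| forces Q_{c,s(θ)}(q) ≠ 0). The parametrized integral realizes −(1/(4π(m+1)(m+2)))∫_{∂(B_r(0)∩ℂ_J)} F_L(s,q) ds_J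 s^{m+2} with ds_J = ds(−J). -/
noncomputable section

open Quaternion Finset

/-- The quaternionic Fueter-type polynomial `∑ⱼ (k - j + 1) q^{k-j} q̄^j`. -/
def fueterPoly (q : Quaternion ℝ) (k : ℕ) : Quaternion ℝ :=
  ∑ j ∈ Finset.range (k + 1), ((k : ℝ) - (j : ℝ) + 1) • (q ^ (k - j) * (star q) ^ j)

lemma fueterPoly_zero (q : Quaternion ℝ) : fueterPoly q 0 = 1 := by
  simp [fueterPoly]

lemma fueterPoly_succ (q : Quaternion ℝ) (k : ℕ) :
    fueterPoly q (k + 1) = ((k : ℝ) + 2) • q ^ (k + 1) + star q * fueterPoly q k := by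
  have hc : Commute (star q) q := (star_comm_self' q)
  unfold fueterPoly
  rw [Finset.sum_range_succ', add_comm, Finset.mul_sum]
  congr 1
  · simp only [Nat.cast_add, Nat.cast_one, Nat.cast_zero, sub_zero, Nat.sub_zero, pow_zero, mul_one]
    congr 1
    ring
  · refine Finset.sum_congr rfl fun j _ => ?_
    rw [mul_smul_comm, ← mul_assoc, (hc.pow_right (k - j)).eq, mul_assoc, ← pow_succ',
      Nat.add_sub_add_right]
    congr 1
    push_cast
    ring

lemma norm_fueterPoly_le (q : Quaternion ℝ) (k : ℕ) :
    ‖fueterPoly q k‖ ≤ ((k : ℝ) + 1) ^ 2 * ‖q‖ ^ k := by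
  have hterm : ∀ j ∈ Finset.range (k + 1),
      ‖((k : ℝ) - (j : ℝ) + 1) • (q ^ (k - j) * (star q) ^ j)‖ ≤ ((k : ℝ) + 1) * ‖q‖ ^ k := by
    intro j hj
    have hjk : j ≤ k := by simpa [Nat.lt_succ_iff] using hj
    have hjk' : (j : ℝ) ≤ k := by exact_mod_cast hjk
    rw [norm_smul, norm_mul, norm_pow, norm_pow, norm_star, ← pow_add, Nat.sub_add_cancel hjk,
      Real.norm_of_nonneg (by linarith)]
    gcongr
    linarith [(Nat.cast_nonneg j : (0 : ℝ) ≤ j)]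
  refine (norm_sum_le_of_le _ hterm).trans (le_of_eq ?_)
  simp only [Finset.sum_const, Finset.card_range, nsmul_eq_mul]
  push_cast
  ring

lemma summable_sq_mul_geometric {x : ℝ} (hx0 : 0 ≤ x) (hx1 : x < 1) :
    Summable fun k : ℕ => ((k : ℝ) + 1) ^ 2 * x ^ k := by
  have h (n : ℕ) := summable_pow_mul_geometric_of_norm_lt_one (R := ℝ) n (r := x)
    (by rwa [Real.norm_of_nonneg hx0])
  refine (((h 2).add ((h 1).mul_left 2)).add (h 0)).congr fun k => ?_
  ring

/-- Applying `X ↦ X s - a X` to a series in negative powers of `s`. -/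
lemma HasSum.mul_sub_mul_of_inv_powers {s a X : Quaternion ℝ} (hs : s ≠ 0) {f g : ℕ → Quaternion ℝ}
    {n : ℕ} (h0 : g 0 = f 0) (hg : ∀ k, g (k + 1) = f (k + 1) - a * f k)
    (hf : HasSum (fun k => f k * s⁻¹ ^ (k + n + 1)) X) :
    HasSum (fun k => g k * s⁻¹ ^ (k + n)) (X * s - a * X) := by
  have h1 : HasSum (fun k => f k * s⁻¹ ^ (k + n)) (X * s) := by
    refine (hf.mul_right s).congr_fun ?_
    intro k
    simp only [pow_succ, mul_assoc, inv_mul_cancel₀ hs, mul_one]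
  rw [← hasSum_nat_add_iff' 1] at h1 ⊢
  convert h1.sub (hf.mul_left a) using 1
  · ext1 k
    rw [hg, sub_mul, mul_assoc, show k + 1 + n = k + n + 1 by ring]
  · simp only [Finset.sum_range_one, h0]
    abel

lemma mul_Qcs (X s q : Quaternion ℝ) :
    X * Qcs s q = (X * s - star q * X) * s - q * (X * s - star q * X) := by
  have h1 : 2 * (q.re : Quaternion ℝ) = q + star q := by
    rw [Quaternion.self_add_star]
  have h2 : ((‖q‖ ^ 2 : ℝ) : Quaternion ℝ) = q * star q := by
    rw [Quaternion.self_mul_star, Quaternion.normSq_eq_norm_mul_self, sq]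
  have h3 : X * (2 * (q.re : Quaternion ℝ)) = (2 * (q.re : Quaternion ℝ)) * X := by
    rw [two_mul, mul_add, add_mul, Quaternion.coe_commutes]
  rw [Qcs, mul_add, mul_sub, ← mul_assoc X _ s, h3,
    ← Quaternion.coe_commutes (‖q‖ ^ 2) X, h1, h2]
  noncomm_ring

lemma mul_Qcs' (X s q : Quaternion ℝ) :
    X * Qcs s q = (X * s - q * X) * s - star q * (X * s - q * X) := by
  rw [mul_Qcs]
  have : star q * (q * X) = q * (star q * X) := by
    rw [← mul_assoc, ← mul_assoc, star_comm_self' q]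
  simp only [mul_sub, sub_mul, this, mul_assoc]
  abel

/-- Laurent expansion of `(s - q̄) Q_{c,s}(q)⁻²` for `|q| < |s|`. -/
lemma hasSum_fueterPoly_mul_inv_pow {s q : Quaternion ℝ} (h : ‖q‖ < ‖s‖) :
    HasSum (fun k => fueterPoly q k * s⁻¹ ^ (k + 3))
      ((s - star q) * ((Qcs s q) ^ 2)⁻¹) := by
  have hs0 : 0 < ‖s‖ := (norm_nonneg q).trans_lt h
  have hs : s ≠ 0 := norm_pos_iff.mp hs0
  have hsum : Summable fun k => fueterPoly q k * s⁻¹ ^ (k + 3) := by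
    refine Summable.of_norm_bounded
      ((summable_sq_mul_geometric (x := ‖q‖ / ‖s‖) (by positivity)
        ((div_lt_one hs0).mpr h)).mul_right (‖s‖⁻¹ ^ 3)) fun k => ?_
    rw [norm_mul, norm_pow, norm_inv, div_pow, pow_add, ← mul_assoc]
    refine mul_le_mul_of_nonneg_right ?_ (by positivity)
    rw [div_eq_mul_inv, ← mul_assoc, ← inv_pow]
    exact mul_le_mul_of_nonneg_right (norm_fueterPoly_le q k) (by positivity)
  obtain ⟨D, hD⟩ := hsum
  have hE := HasSum.mul_sub_mul_of_inv_powers hs (n := 2) (a := star q)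
    (g := fun k : ℕ => ((k : ℝ) + 1) • q ^ k) (by simp [fueterPoly_zero])
    (fun k => by
      rw [fueterPoly_succ]
      push_cast
      rw [add_sub_cancel_right, add_assoc, one_add_one_eq_two]) hD
  have hC := HasSum.mul_sub_mul_of_inv_powers hs (n := 1) (a := q)
    (g := fun k : ℕ => q ^ k) (by simp)
    (fun k => by
      rw [mul_smul_comm, ← pow_succ', ← sub_smul]
      push_cast
      rw [add_sub_cancel_left, one_smul]) hE
  rw [← mul_Qcs] at hC
  have hone := HasSum.mul_sub_mul_of_inv_powers hs (n := 0) (a := q)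
    (g := fun k : ℕ => if k = 0 then 1 else 0) (by simp)
    (fun k => by simp [pow_succ']) hC
  have hC1 : D * Qcs s q * s - q * (D * Qcs s q) = 1 :=
    hone.unique <| by
      convert hasSum_ite_eq (0 : ℕ) (1 : Quaternion ℝ) using 2 with k
      split_ifs with hk <;> simp [hk]
  have hCQ : D * Qcs s q * Qcs s q = s - star q := by
    rw [mul_Qcs' (D * Qcs s q), hC1, one_mul, mul_one]
  have hQ : Qcs s q ≠ 0 := by
    intro hQ
    rw [hQ, mul_zero, eq_comm, sub_eq_zero] at hCQ
    rw [hCQ, norm_star] at h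
    exact h.false
  have hval : (s - star q) * ((Qcs s q) ^ 2)⁻¹ = D := by
    rw [← hCQ, mul_assoc D, ← sq, mul_inv_cancel_right₀ (pow_ne_zero 2 hQ)]
  rwa [hval]

lemma integral_circleMap_zpow {r : ℝ} (hr : r ≠ 0) (n : ℤ) :
    ∫ θ in (0 : ℝ)..(2 * Real.pi), circleMap 0 r θ ^ n
      = if n = 0 then (2 * Real.pi : ℂ) else 0 := by
  split_ifs with hn
  · simp [hn]
  · have h := circleIntegral.integral_sub_zpow_of_ne (n := n - 1) (by omega) (0 : ℂ) 0 r
    rw [circleIntegral] at h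
    have h2 : ∀ θ : ℝ, deriv (circleMap 0 r) θ • (circleMap 0 r θ - 0) ^ (n - 1)
        = circleMap 0 r θ ^ n * Complex.I := by
      intro θ
      have h0 : circleMap 0 r θ ≠ 0 := circleMap_ne_center hr
      rw [deriv_circleMap, sub_zero, smul_eq_mul, zpow_sub_one₀ h0]
      field_simp
    simp only [h2] at h
    rw [intervalIntegral.integral_mul_const] at h
    simpa using h

lemma norm_complexLift_apply {J : Quaternion ℝ} (hJre : J.re = 0) (hJ1 : ‖J‖ = 1)
    (hJ : J * J = -1) (z : ℂ) : ‖Complex.lift ⟨J, hJ⟩ z‖ = ‖z‖ := by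
  have hJsq : J.imI ^ 2 + J.imJ ^ 2 + J.imK ^ 2 = 1 := by
    have h := Quaternion.normSq_eq_norm_mul_self J
    rw [hJ1, Quaternion.normSq_def', hJre] at h
    linarith
  rw [← sq_eq_sq₀ (norm_nonneg _) (norm_nonneg _), sq, ← Quaternion.normSq_eq_norm_mul_self,
    Quaternion.normSq_def', Complex.sq_norm, Complex.normSq_apply, Complex.lift_apply,
    Complex.liftAux_apply, Quaternion.algebraMap_def]
  simp only [Quaternion.re_add, Quaternion.imI_add, Quaternion.imJ_add, Quaternion.imK_add,
    Quaternion.re_coe, Quaternion.imI_coe, Quaternion.imJ_coe, Quaternion.imK_coe,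
    Quaternion.re_smul, Quaternion.imI_smul, Quaternion.imJ_smul, Quaternion.imK_smul,
    smul_eq_mul, hJre]
  linear_combination z.im ^ 2 * hJsq

/-- Fueter-polynomial moment formula for the F-kernel (ball version): for `r > |q|`, `J ∈ 𝕊`
and `s(θ) = r(cos θ + J sin θ)`,
`−(1/(4π(m+1)(m+2))) ∫₀^{2π} F_L(s(θ),q) · r(cos θ + J sin θ) · s(θ)^{m+2} dθ
  = ∑_{j=0}^{m} (2(m−j+1)/((m+1)(m+2))) q^{m−j} q̄^{j}`. -/
theorem Fkernel_moment_formula (q : Quaternion ℝ) (m : ℕ) (r : ℝ) (hr : ‖q‖ < r)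
    (J : Quaternion ℝ) (hJre : J.re = 0) (hJ1 : ‖J‖ = 1) :
    -(1 / (4 * Real.pi * ((m : ℝ) + 1) * ((m : ℝ) + 2))) •
      ∫ θ in (0 : ℝ)..(2 * Real.pi),
        FL (((r * Real.cos θ : ℝ) : Quaternion ℝ) + (r * Real.sin θ) • J) q *
          (((r * Real.cos θ : ℝ) : Quaternion ℝ) + (r * Real.sin θ) • J) *
          (((r * Real.cos θ : ℝ) : Quaternion ℝ) + (r * Real.sin θ) • J) ^ (m + 2)
    = ∑ j ∈ Finset.range (m + 1),
        ((2 * ((m : ℝ) - (j : ℝ) + 1)) / (((m : ℝ) + 1) * ((m : ℝ) + 2))) •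
          (q ^ (m - j) * (star q) ^ j) := by
  have hr0 : 0 < r := (norm_nonneg q).trans_lt hr
  have hJ : J * J = -1 := by
    have hstar : star J = -J := by
      ext <;> simp [hJre]
    have h := Quaternion.self_mul_star J
    rw [hstar, Quaternion.normSq_eq_norm_mul_self, hJ1] at h
    simpa [neg_eq_iff_eq_neg] using h
  set φ : ℂ →ₐ[ℝ] Quaternion ℝ := Complex.lift ⟨J, hJ⟩ with hφ
  have hφs : ∀ θ : ℝ, ((r * Real.cos θ : ℝ) : Quaternion ℝ) + (r * Real.sin θ) • J
      = φ (circleMap 0 r θ) := by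
    intro θ
    rw [hφ, Complex.lift_apply, Complex.liftAux_apply]
    simp [circleMap, Complex.exp_ofReal_mul_I_re, Complex.exp_ofReal_mul_I_im]
  simp only [hφs]
  have hφnorm : ∀ z : ℂ, ‖φ z‖ = ‖z‖ := norm_complexLift_apply hJre hJ1 hJ
  have hcirc : ∀ θ : ℝ, ‖circleMap 0 r θ‖ = r := fun θ => by
    rw [norm_circleMap_zero, abs_of_pos hr0]
  have hpow : ∀ (k : ℕ) (θ : ℝ),
      fueterPoly q k * (φ (circleMap 0 r θ))⁻¹ ^ (k + 3) * φ (circleMap 0 r θ) *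
        φ (circleMap 0 r θ) ^ (m + 2)
      = fueterPoly q k * φ (circleMap 0 r θ ^ ((m : ℤ) - k)) := by
    intro k θ
    have h0 : circleMap 0 r θ ≠ 0 := circleMap_ne_center hr0.ne'
    rw [mul_assoc, mul_assoc, ← pow_succ', ← map_inv₀, ← map_pow, ← map_pow, ← map_mul]
    congr 2
    rw [← zpow_natCast, ← zpow_natCast, inv_zpow', ← zpow_add₀ h0]
    congr 1
    push_cast
    ring
  have hsum : ∀ θ : ℝ, HasSum
      (fun k : ℕ => (-4 : ℝ) • (fueterPoly q k * φ (circleMap 0 r θ ^ ((m : ℤ) - k))))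
      (FL (φ (circleMap 0 r θ)) q * φ (circleMap 0 r θ) * φ (circleMap 0 r θ) ^ (m + 2)) := by
    intro θ
    have h := (((hasSum_fueterPoly_mul_inv_pow
      (s := φ (circleMap 0 r θ)) (q := q) (by rwa [hφnorm, hcirc])).mul_right (φ (circleMap 0 r θ))).mul_right
      (φ (circleMap 0 r θ) ^ (m + 2))).const_smul (-4 : ℝ)
    simp only [hpow] at h
    have hFL : FL (φ (circleMap 0 r θ)) q = (-4 : ℝ) •
        ((φ (circleMap 0 r θ) - star q) * (Qcs (φ (circleMap 0 r θ)) q ^ 2)⁻¹) := by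
      rw [FL, mul_assoc, Algebra.smul_def, map_neg, map_ofNat]
    rwa [hFL, smul_mul_assoc, smul_mul_assoc]
  let L : ℂ →L[ℝ] Quaternion ℝ := LinearMap.toContinuousLinearMap φ.toLinearMap
  have hcont : ∀ n : ℤ, Continuous fun θ : ℝ => circleMap 0 r θ ^ n := fun n =>
    (continuous_circleMap 0 r).zpow₀ n fun θ => Or.inl (circleMap_ne_center hr0.ne')
  have hint : ∀ k : ℕ,
      ∫ θ in (0 : ℝ)..(2 * Real.pi),
        (-4 : ℝ) • (fueterPoly q k * φ (circleMap 0 r θ ^ ((m : ℤ) - k)))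
      = if k = m then (-4 * (2 * Real.pi) : ℝ) • fueterPoly q m else 0 := by
    intro k
    have h1 : ∫ θ in (0 : ℝ)..(2 * Real.pi), φ (circleMap 0 r θ ^ ((m : ℤ) - k))
        = φ (∫ θ in (0 : ℝ)..(2 * Real.pi), circleMap 0 r θ ^ ((m : ℤ) - k)) :=
      L.intervalIntegral_comp_comm ((hcont _).intervalIntegrable _ _)
    rw [intervalIntegral.integral_smul, intervalIntegral.integral_const_mul, h1,
      integral_circleMap_zpow hr0.ne']
    by_cases hk : k = m
    · subst hk
      have h2 : (2 * Real.pi : ℂ) = algebraMap ℝ ℂ (2 * Real.pi) := by simp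
      rw [if_pos (sub_self _), if_pos rfl, h2, AlgHom.commutes, ← Algebra.commutes,
        ← Algebra.smul_def, smul_smul]
    · rw [if_neg (by omega), if_neg hk, map_zero, mul_zero, smul_zero]
  have hall := intervalIntegral.hasSum_integral_of_dominated_convergence
    (μ := MeasureTheory.volume) (a := 0) (b := 2 * Real.pi)
    (fun (k : ℕ) _ => 4 * (((k : ℝ) + 1) ^ 2 * (‖q‖ / r) ^ k * r ^ m))
    (fun k => (((L.continuous.comp (hcont ((m : ℤ) - k))).const_mul
      (fueterPoly q k)).const_smul (-4 : ℝ)).aestronglyMeasurable)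
    (fun k => Filter.Eventually.of_forall fun θ _ => by
      change ‖(-4 : ℝ) • (fueterPoly q k * φ (circleMap 0 r θ ^ ((m : ℤ) - k)))‖ ≤ _
      rw [norm_smul, norm_mul, hφnorm, norm_zpow, hcirc, zpow_sub₀ hr0.ne', zpow_natCast,
        zpow_natCast, norm_neg, Real.norm_ofNat, div_pow]
      refine mul_le_mul_of_nonneg_left ?_ (by norm_num)
      calc ‖fueterPoly q k‖ * (r ^ m / r ^ k)
          ≤ ((k : ℝ) + 1) ^ 2 * ‖q‖ ^ k * (r ^ m / r ^ k) := by
            gcongr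
            exact norm_fueterPoly_le q k
        _ = _ := by ring)
    (Filter.Eventually.of_forall fun _ _ =>
      ((summable_sq_mul_geometric (by positivity) ((div_lt_one hr0).mpr hr)).mul_right
        (r ^ m)).mul_left 4)
    intervalIntegrable_const
    (Filter.Eventually.of_forall fun θ _ => hsum θ)
  have hval := hall.unique (by
    refine (hasSum_ite_eq m ((-4 * (2 * Real.pi) : ℝ) • fueterPoly q m)).congr_fun ?_
    exact fun k => hint k)
  rw [hval, smul_smul, fueterPoly, Finset.smul_sum]
  refine Finset.sum_congr rfl fun j _ => ?_
  rw [smul_smul]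
  congr 1
  field_simp
end
end

section
/- Product rule underlying the F-functional calculus (pointwise form): let U ⊆ ℍ be an axially symmetric open set, let f : U → ℍ be intrinsic slice hyperholomorphic and g : U → ℍ left slice hyperholomorphic, and assume f and g are twice continuously differentiable as maps on U ⊆ ℝ⁴. Then for every q ∈ U: Δ(fg)(q) = (Δf)(q)·g(q) + f(q)·(Δg)(q) − (Df)(q)·(Dg)(q), where fg denotes the pointwise product q ↦ f(q)g(q). -/
noncomputable section

open Quaternion Finset

/-- `(u,v)` lies over the axially symmetric set `U`: the whole sphere `u + 𝕊v` is in `U`. -/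
def inSlice (U : Set (Quaternion ℝ)) (u v : ℝ) : Prop :=
  ∀ J : Quaternion ℝ, J.re = 0 → ‖J‖ = 1 → (u : Quaternion ℝ) + v • J ∈ U

/-- `f` is left slice hyperholomorphic on `U` with components `α, β`: even/odd conditions,
differentiability and the Cauchy–Riemann system hold on `𝒰 = {(u,v) : u + 𝕊v ⊆ U}`, and
`f(u + Jv) = α(u,v) + Jβ(u,v)`. -/
def IsSliceHypL (U : Set (Quaternion ℝ)) (f : Quaternion ℝ → Quaternion ℝ)
    (α β : ℝ → ℝ → Quaternion ℝ) : Prop :=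
  (∀ u v : ℝ, inSlice U u v → α u (-v) = α u v ∧ β u (-v) = -β u v) ∧
  (∀ u v : ℝ, inSlice U u v →
    DifferentiableAt ℝ (fun p : ℝ × ℝ => α p.1 p.2) (u, v) ∧
    DifferentiableAt ℝ (fun p : ℝ × ℝ => β p.1 p.2) (u, v) ∧
    deriv (fun t => α t v) u - deriv (fun t => β u t) v = 0 ∧
    deriv (fun t => α u t) v + deriv (fun t => β t v) u = 0) ∧
  (∀ (u v : ℝ) (J : Quaternion ℝ), J.re = 0 → ‖J‖ = 1 →
    (u : Quaternion ℝ) + v • J ∈ U → f ((u : Quaternion ℝ) + v • J) = α u v + J * β u v)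

lemma dir2_mul {f g : Quaternion ℝ → Quaternion ℝ} {q : Quaternion ℝ}
    (hf : ContDiffAt ℝ 2 f q) (hg : ContDiffAt ℝ 2 g q) (v : Quaternion ℝ) :
    dir2 (fun x => f x * g x) v q
      = dir2 f v q * g q + f q * dir2 g v q + 2 * (fderiv ℝ f q v * fderiv ℝ g q v) := by
  have key {h : Quaternion ℝ → Quaternion ℝ} (hh : ContDiffAt ℝ 2 h q) :
      DifferentiableAt ℝ (fun x => fderiv ℝ h x v) q :=
    ((hh.fderiv_right (m := 1) (by norm_num)).differentiableAt (by norm_num)).clm_apply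
      (differentiableAt_const v)
  have hev : (fun x => fderiv ℝ (fun y => f y * g y) x v) =ᶠ[nhds q]
      fun x => f x * fderiv ℝ g x v + fderiv ℝ f x v * g x := by
    filter_upwards [hf.eventually (by simp), hg.eventually (by simp)] with x hfx hgx
    rw [fderiv_fun_mul' (hfx.differentiableAt (by norm_num)) (hgx.differentiableAt (by norm_num))]
    simp
  have hf1 := hf.differentiableAt (by norm_num)
  have hg1 := hg.differentiableAt (by norm_num)
  unfold dir2
  rw [hev.fderiv_eq, fderiv_fun_add (hf1.fun_mul (key hg)) ((key hf).fun_mul hg1),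
    fderiv_fun_mul' hf1 (key hg), fderiv_fun_mul' (key hf) hg1]
  simp [two_mul]
  abel

lemma commute_of_im_eq_zero {a : Quaternion ℝ} (h : a.im = 0) (b : Quaternion ℝ) :
    a * b = b * a := by
  have : a = (a.re : Quaternion ℝ) := by
    conv_lhs => rw [← Quaternion.re_add_im a, h, add_zero]
  rw [this]
  exact Quaternion.coe_commutes _ _

lemma commute_of_hasDerivAt {F : ℝ → Quaternion ℝ} {F' : Quaternion ℝ} {t : ℝ}
    (hF : HasDerivAt F F' t) (h : ∀ᶠ s in nhds t, (F s).im = 0) (x : Quaternion ℝ) :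
    F' * x = x * F' :=
  (hF.mul_const x).unique ((hF.const_mul x).congr_of_eventuallyEq
    (h.mono fun _ hs => commute_of_im_eq_zero hs x))

lemma e1_components : e1.re = 0 ∧ e1.imI = 1 ∧ e1.imJ = 0 ∧ e1.imK = 0 := ⟨rfl, rfl, rfl, rfl⟩

lemma e2_components : e2.re = 0 ∧ e2.imI = 0 ∧ e2.imJ = 1 ∧ e2.imK = 0 := ⟨rfl, rfl, rfl, rfl⟩

lemma e3_components : e3.re = 0 ∧ e3.imI = 0 ∧ e3.imJ = 0 ∧ e3.imK = 1 := ⟨rfl, rfl, rfl, rfl⟩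

/-- The identity `2 ∑ᵢ (∂ᵢf)(∂ᵢg) = -(Df)(Dg)` for directional derivatives of the form produced by
`IsSliceHypL.exists_fderiv`. -/
lemma slice_algebra {J a b c d A₁ A₂ A₃ B₁ B₂ B₃ : Quaternion ℝ}
    (hJre : J.re = 0) (hJ : J * J = -1) (haJ : a * J = J * a)
    (hb : ∀ x, b * x = x * b)
    (hA₁ : A₁ = e1 * b + J.imI • (J * (a - b))) (hA₂ : A₂ = e2 * b + J.imJ • (J * (a - b)))
    (hA₃ : A₃ = e3 * b + J.imK • (J * (a - b)))
    (hB₁ : B₁ = e1 * d + J.imI • (J * (c - d))) (hB₂ : B₂ = e2 * d + J.imJ • (J * (c - d)))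
    (hB₃ : B₃ = e3 * d + J.imK • (J * (c - d))) :
    2 * (a * c + A₁ * B₁ + A₂ * B₂ + A₃ * B₃) =
      -((a + e1 * A₁ + e2 * A₂ + e3 * A₃) * (c + e1 * B₁ + e2 * B₂ + e3 * B₃)) := by
  have hsum : J.imI • e1 + J.imJ • e2 + J.imK • e3 = J := by
    ext <;> simp [e1_components, e2_components, e3_components, hJre]
  have h1 : e1 * e1 = -1 := by ext <;> simp [e1_components]
  have h2 : e2 * e2 = -1 := by ext <;> simp [e2_components]
  have h3 : e3 * e3 = -1 := by ext <;> simp [e3_components]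
  have hnorm : J.imI ^ 2 + J.imJ ^ 2 + J.imK ^ 2 = 1 := by
    have := congrArg (fun x : Quaternion ℝ => x.re) hJ
    simp [hJre] at this
    linarith
  have hJJ (x : Quaternion ℝ) : J * (J * x) = -x := by rw [← mul_assoc, hJ]; simp
  have hJba (x : Quaternion ℝ) : (J * (a - b)) * (J * x) = -((a - b) * x) := by
    have : J * (a - b) = (a - b) * J := by rw [mul_sub, sub_mul, haJ, hb]
    rw [this, mul_assoc, hJJ, mul_neg]
  have fueter (a b : Quaternion ℝ) :
      a + e1 * (e1 * b + J.imI • (J * (a - b))) + e2 * (e2 * b + J.imJ • (J * (a - b)))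
        + e3 * (e3 * b + J.imK • (J * (a - b))) = -(2 * b) := by
    have : a + e1 * (e1 * b + J.imI • (J * (a - b))) + e2 * (e2 * b + J.imJ • (J * (a - b)))
        + e3 * (e3 * b + J.imK • (J * (a - b))) = a + (e1 * e1 + e2 * e2 + e3 * e3) * b
          + (J.imI • e1 + J.imJ • e2 + J.imK • e3) * (J * (a - b)) := by
      simp only [mul_add, add_mul, smul_mul_assoc, mul_smul_comm, mul_assoc]
      abel
    rw [this, hsum, hJJ, h1, h2, h3]
    noncomm_ring
  have cross (e : Quaternion ℝ) (j : ℝ) (he : e * e = -1) :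
      (e * b + j • (J * (a - b))) * (e * d + j • (J * (c - d)))
        = -(b * d) + b * ((j • e) * (J * (c - d))) + (J * (a - b)) * ((j • e) * d)
          + j ^ 2 • -((a - b) * (c - d)) := by
    have hbe : e * b * (e * d) = -(b * d) := by
      rw [← hb e, mul_assoc, ← mul_assoc e e d, he]
      simp
    rw [add_mul, mul_add, mul_add, hbe, ← hJba, ← hb e]
    simp only [smul_mul_assoc, mul_smul_comm, mul_assoc, smul_smul, pow_two]
    abel
  have total : a * c + A₁ * B₁ + A₂ * B₂ + A₃ * B₃ = -(2 * (b * d)) := by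
    rw [hA₁, hA₂, hA₃, hB₁, hB₂, hB₃, cross _ _ h1, cross _ _ h2, cross _ _ h3]
    have : a * c - 3 * (b * d)
        + b * ((J.imI • e1 + J.imJ • e2 + J.imK • e3) * (J * (c - d)))
        + (J * (a - b)) * ((J.imI • e1 + J.imJ • e2 + J.imK • e3) * d)
        + (J.imI ^ 2 + J.imJ ^ 2 + J.imK ^ 2) • -((a - b) * (c - d)) = -(2 * (b * d)) := by
      rw [hsum, hnorm, hJJ, hJba, one_smul]
      noncomm_ring
    rw [← this]
    simp only [add_mul, mul_add, add_smul]
    noncomm_ring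
  rw [total, hA₁, hA₂, hA₃, hB₁, hB₂, hB₃, fueter, fueter, neg_mul_neg, mul_assoc 2 b,
    ← mul_assoc b 2 d, hb 2]
  noncomm_ring

lemma imaginary_unit_mul_self {J : Quaternion ℝ} (hJ : J.re = 0) (hJn : ‖J‖ = 1) :
    J * J = -1 := by
  have h := Quaternion.self_mul_star J
  rw [Quaternion.star_eq_neg.mpr hJ, Quaternion.normSq_eq_norm_mul_self, hJn] at h
  simpa [neg_eq_iff_eq_neg] using h

lemma norm_e1 : ‖e1‖ = 1 := by
  rw [norm_eq_sqrt_real_inner, Quaternion.inner_def]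
  simp [e1_components]

lemma norm_e2 : ‖e2‖ = 1 := by
  rw [norm_eq_sqrt_real_inner, Quaternion.inner_def]
  simp [e2_components]

lemma norm_e3 : ‖e3‖ = 1 := by
  rw [norm_eq_sqrt_real_inner, Quaternion.inner_def]
  simp [e3_components]

lemma exists_eq_add_smul_unit (q : Quaternion ℝ) :
    ∃ (u v : ℝ) (J : Quaternion ℝ), J.re = 0 ∧ ‖J‖ = 1 ∧ 0 ≤ v ∧
      q = (u : Quaternion ℝ) + v • J := by
  by_cases h : q.im = 0
  · refine ⟨q.re, 0, e1, rfl, norm_e1, le_rfl, ?_⟩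
    conv_lhs => rw [← Quaternion.re_add_im q, h]
    rw [zero_smul]
  · refine ⟨q.re, ‖q.im‖, ‖q.im‖⁻¹ • q.im, by simp, ?_, norm_nonneg _, ?_⟩
    · rw [norm_smul, norm_inv, norm_norm, inv_mul_cancel₀ (norm_ne_zero_iff.mpr h)]
    · rw [smul_smul, mul_inv_cancel₀ (norm_ne_zero_iff.mpr h), one_smul, Quaternion.re_add_im]

lemma norm_add_smul_eq_sqrt {E : Type*} [NormedAddCommGroup E] [InnerProductSpace ℝ E]
    {x y : E} (hx : ‖x‖ = 1) (hy : ‖y‖ = 1) (v t : ℝ) :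
    ‖v • x + t • y‖ = √(v ^ 2 + 2 * v * t * inner ℝ x y + t ^ 2) := by
  rw [← Real.sqrt_sq (norm_nonneg (v • x + t • y)), norm_add_sq_real]
  simp only [norm_smul, hx, hy, real_inner_smul_left, real_inner_smul_right, mul_one,
    Real.norm_eq_abs, sq_abs]
  ring_nf

lemma DifferentiableAt.hasDerivAt_uncurry_left {F : Type*} [NormedAddCommGroup F] [NormedSpace ℝ F]
    {φ : ℝ → ℝ → F} {u v : ℝ} (h : DifferentiableAt ℝ (fun p : ℝ × ℝ => φ p.1 p.2) (u, v)) :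
    HasDerivAt (fun t => φ t v) (deriv (fun t => φ t v) u) u :=
  (h.comp (f := fun t : ℝ => (t, v)) u (by fun_prop)).hasDerivAt

lemma DifferentiableAt.hasDerivAt_uncurry_right {F : Type*} [NormedAddCommGroup F] [NormedSpace ℝ F]
    {φ : ℝ → ℝ → F} {u v : ℝ} (h : DifferentiableAt ℝ (fun p : ℝ × ℝ => φ p.1 p.2) (u, v)) :
    HasDerivAt (fun t => φ u t) (deriv (fun t => φ u t) v) v :=
  (h.comp (f := fun t : ℝ => (u, t)) v (by fun_prop)).hasDerivAt

lemma DifferentiableAt.hasDerivAt_line {f : Quaternion ℝ → Quaternion ℝ} {q : Quaternion ℝ}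
    (hd : DifferentiableAt ℝ f q) (h : Quaternion ℝ) :
    HasDerivAt (fun t : ℝ => f (q + t • h)) (fderiv ℝ f q h) 0 := by
  exact hd.hasFDerivAt.hasLineDerivAt h

/-- Directional derivatives of a slice hyperholomorphic function at `u + vJ`. -/
lemma IsSliceHypL.exists_fderiv {U : Set (Quaternion ℝ)} (hopen : IsOpen U)
    (hax : ∀ (u v : ℝ) (J : Quaternion ℝ), J.re = 0 → ‖J‖ = 1 →
      (u : Quaternion ℝ) + v • J ∈ U →
      ∀ J' : Quaternion ℝ, J'.re = 0 → ‖J'‖ = 1 → (u : Quaternion ℝ) + v • J' ∈ U)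
    {f : Quaternion ℝ → Quaternion ℝ} {α β : ℝ → ℝ → Quaternion ℝ} (hf : IsSliceHypL U f α β)
    {u v : ℝ} {J : Quaternion ℝ} (hJ : J.re = 0) (hJn : ‖J‖ = 1) (hv : 0 ≤ v)
    (hq : (u : Quaternion ℝ) + v • J ∈ U)
    (hd : DifferentiableAt ℝ f ((u : Quaternion ℝ) + v • J)) :
    ∃ r s b : Quaternion ℝ,
      ((∀ u v : ℝ, inSlice U u v → (α u v).im = 0 ∧ (β u v).im = 0) →
        ∀ x, r * x = x * r ∧ s * x = x * s ∧ b * x = x * b) ∧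
      fderiv ℝ f ((u : Quaternion ℝ) + v • J) 1 = r + J * s ∧
      ∀ h : Quaternion ℝ, h.re = 0 → ‖h‖ = 1 →
        fderiv ℝ f ((u : Quaternion ℝ) + v • J) h
          = h * b + (inner ℝ J h : ℝ) • (J * (r + J * s - b)) := by
  obtain ⟨hsym, hCR, hrep⟩ := hf
  have hslice : inSlice U u v := hax u v J hJ hJn hq
  obtain ⟨hα, hβ, hCR1, hCR2⟩ := hCR u v hslice
  have hαu := DifferentiableAt.hasDerivAt_uncurry_left hα
  have hβu := DifferentiableAt.hasDerivAt_uncurry_left hβ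
  have hαv := DifferentiableAt.hasDerivAt_uncurry_right hα
  have hβv := DifferentiableAt.hasDerivAt_uncurry_right hβ
  rw [← sub_eq_zero.mp hCR1] at hβv
  rw [eq_neg_of_add_eq_zero_left hCR2] at hαv
  set r := deriv (fun t => α t v) u
  set s := deriv (fun t => β t v) u
  have hline (h : Quaternion ℝ) :
      ∀ᶠ t : ℝ in nhds 0, (u : Quaternion ℝ) + v • J + t • h ∈ U := by
    have hc : ContinuousAt (fun t : ℝ => (u : Quaternion ℝ) + v • J + t • h) 0 := by fun_prop
    exact hc.eventually_mem (hopen.mem_nhds (by simpa using hq))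
  have hreal (t : ℝ) : (u : Quaternion ℝ) + v • J + t • (1 : Quaternion ℝ)
      = ((u + t : ℝ) : Quaternion ℝ) + v • J := by
    ext <;> simp; ring
  have hmem : ∀ᶠ t : ℝ in nhds u, inSlice U t v := by
    have hc : ContinuousAt (fun t : ℝ => (t : Quaternion ℝ) + v • J) u :=
      (Quaternion.continuous_coe.add continuous_const).continuousAt
    exact (hc.eventually_mem (hopen.mem_nhds hq)).mono fun t ht => hax t v J hJ hJn ht
  have hone : fderiv ℝ f ((u : Quaternion ℝ) + v • J) 1 = r + J * s := by
    refine (hd.hasDerivAt_line 1).unique ?_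
    have h1 : HasDerivAt (fun t : ℝ => α (u + t) v + J * β (u + t) v) (r + J * s) 0 := by
      refine HasDerivAt.add ?_ (HasDerivAt.const_mul J ?_)
      · exact HasDerivAt.comp_const_add u 0 (by simpa using hαu)
      · exact HasDerivAt.comp_const_add u 0 (by simpa using hβu)
    refine h1.congr_of_eventuallyEq ?_
    filter_upwards [hline 1] with t ht
    rw [hreal] at ht ⊢
    exact hrep _ _ _ hJ hJn ht
  have hcomm (hi : ∀ u v : ℝ, inSlice U u v → (α u v).im = 0 ∧ (β u v).im = 0) :
      ∀ x, r * x = x * r ∧ s * x = x * s := fun x =>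
    ⟨commute_of_hasDerivAt hαu (hmem.mono fun t ht => (hi t v ht).1) x,
      commute_of_hasDerivAt hβu (hmem.mono fun t ht => (hi t v ht).2) x⟩
  rcases hv.eq_or_lt with rfl | hv
  · have hs : s = 0 := by
      refine hβu.unique ((hasDerivAt_const u (0 : Quaternion ℝ)).congr_of_eventuallyEq ?_)
      filter_upwards [hmem] with t ht
      have := (hsym t 0 ht).2
      rw [neg_zero] at this
      have h2 : (2 : ℝ) • β t 0 = 0 := by
        rw [two_smul]
        nth_rewrite 1 [this]
        exact neg_add_cancel _
      exact (smul_eq_zero.mp h2).resolve_left two_ne_zero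
    refine ⟨r, s, r, fun hi x => ⟨(hcomm hi x).1, (hcomm hi x).2, (hcomm hi x).1⟩, hone, ?_⟩
    intro h hh hhn
    rw [hs, mul_zero, add_zero, sub_self, mul_zero, smul_zero, add_zero]
    refine (hd.hasDerivAt_line h).unique ?_
    have h1 : HasDerivAt (fun t : ℝ => α u t + h * β u t) (-s + h * r) 0 :=
      hαv.add (hβv.const_mul h)
    rw [hs, neg_zero, zero_add] at h1
    refine h1.congr_of_eventuallyEq ?_
    filter_upwards [hline h] with t ht
    rw [zero_smul, add_zero] at ht ⊢
    exact hrep _ _ _ hh hhn ht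
  · refine ⟨r, s, v⁻¹ • β u v, fun hi x => ⟨(hcomm hi x).1, (hcomm hi x).2, ?_⟩, hone, ?_⟩
    · rw [smul_mul_assoc, mul_smul_comm, commute_of_im_eq_zero (hi u v hslice).2]
    intro h hh hhn
    set c : ℝ := inner ℝ J h
    set n : ℝ → ℝ := fun t => √(v ^ 2 + 2 * v * t * c + t ^ 2)
    have hn (t : ℝ) : ‖v • J + t • h‖ = n t := norm_add_smul_eq_sqrt hJn hhn v t
    have hn0 : n 0 = v := by simp [n, Real.sqrt_sq hv.le]
    have hn' : HasDerivAt n c 0 := by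
      have h1 : HasDerivAt (fun t : ℝ => v ^ 2 + 2 * v * t * c + t ^ 2) (2 * v * c) 0 := by
        have := ((((hasDerivAt_id (0 : ℝ)).const_mul (2 * v)).mul_const c).const_add
          (v ^ 2)).add ((hasDerivAt_id (0 : ℝ)).pow 2)
        exact this.congr_deriv (by simp)
      have h2 := h1.sqrt (by simp [hv.ne'])
      convert h2 using 1
      simp [Real.sqrt_sq hv.le]
      field_simp
    have hαn : HasDerivAt (fun t => α u (n t)) (c • -s) 0 :=
      HasDerivAt.scomp (g₁ := α u) (0 : ℝ) (by rw [hn0]; exact hαv) hn'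
    have hβn : HasDerivAt (fun t => β u (n t)) (c • r) 0 :=
      HasDerivAt.scomp (g₁ := β u) (0 : ℝ) (by rw [hn0]; exact hβv) hn'
    have hlin : HasDerivAt (fun t : ℝ => v • J + t • h) h 0 := by
      simpa using ((hasDerivAt_id (0 : ℝ)).smul_const h).const_add (v • J)
    have hJt := (hn'.inv (by rw [hn0]; exact hv.ne')).smul hlin
    have htot := hαn.add (hJt.mul hβn)
    refine (hd.hasDerivAt_line h).unique ((htot.congr_of_eventuallyEq ?_).congr_deriv ?_)
    · have hpos : ∀ᶠ t in nhds 0, 0 < n t :=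
        hn'.continuousAt.eventually_mem (isOpen_Ioi.mem_nhds (by simpa [hn0] using hv))
      filter_upwards [hline h, hpos] with t ht htn
      have e : (u : Quaternion ℝ) + v • J + t • h
          = (u : Quaternion ℝ) + n t • ((n t)⁻¹ • (v • J + t • h)) := by
        rw [smul_smul, mul_inv_cancel₀ htn.ne', one_smul, add_assoc]
      rw [e] at ht ⊢
      refine hrep _ _ _ ?_ ?_ ht
      · simp [hJ, hh]
      · rw [norm_smul, hn, norm_inv, Real.norm_of_nonneg htn.le, inv_mul_cancel₀ htn.ne']
    · have hJJ (x : Quaternion ℝ) : J * (J * x) = -x := by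
        rw [← mul_assoc, imaginary_unit_mul_self hJ hJn, neg_one_mul]
      simp [hn0]
      simp only [mul_add, mul_sub, add_mul, hJJ, smul_mul_assoc, mul_smul_comm]
      match_scalars <;> field_simp

/-- Pointwise product rule underlying the F-functional calculus: for `f` intrinsic slice
hyperholomorphic and `g` left slice hyperholomorphic on an axially symmetric open set `U`,
both twice continuously differentiable on `U`,
`Δ(fg) = (Δf)g + f(Δg) − (Df)(Dg)` on `U`. -/
theorem laplacian_product_rule
    (U : Set (Quaternion ℝ)) (hopen : IsOpen U)
    (hax : ∀ (u v : ℝ) (J : Quaternion ℝ), J.re = 0 → ‖J‖ = 1 →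
      (u : Quaternion ℝ) + v • J ∈ U →
      ∀ J' : Quaternion ℝ, J'.re = 0 → ‖J'‖ = 1 → (u : Quaternion ℝ) + v • J' ∈ U)
    (f g : Quaternion ℝ → Quaternion ℝ)
    (α β γ δ : ℝ → ℝ → Quaternion ℝ)
    (hf : IsSliceHypL U f α β)
    (hintrinsic : ∀ u v : ℝ, inSlice U u v → (α u v).im = 0 ∧ (β u v).im = 0)
    (hg : IsSliceHypL U g γ δ)
    (hf2 : ContDiffOn ℝ 2 f U) (hg2 : ContDiffOn ℝ 2 g U) :
    ∀ q ∈ U,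
      quatLaplacian (fun x => f x * g x) q
        = quatLaplacian f q * g q + f q * quatLaplacian g q - fueterL f q * fueterL g q := by
  intro q hq
  have hfq := hf2.contDiffAt (hopen.mem_nhds hq)
  have hgq := hg2.contDiffAt (hopen.mem_nhds hq)
  have hfd := hfq.differentiableAt (by norm_num)
  have hgd := hgq.differentiableAt (by norm_num)
  obtain ⟨u, v, J, hJ, hJn, hv, rfl⟩ := exists_eq_add_smul_unit q
  obtain ⟨r, s, b, hreal, hf1, hfK⟩ := hf.exists_fderiv hopen hax hJ hJn hv hq hfd
  obtain ⟨r', s', d, -, hg1, hgK⟩ := hg.exists_fderiv hopen hax hJ hJn hv hq hgd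
  specialize hreal hintrinsic
  have hcomm : (r + J * s) * J = J * (r + J * s) := by
    rw [add_mul, mul_add, (hreal J).1, mul_assoc, (hreal J).2.1]
  have hsum := slice_algebra hJ (imaginary_unit_mul_self hJ hJn) hcomm (fun x => (hreal x).2.2)
    (by simpa [Quaternion.inner_def, e1_components] using hfK e1 rfl norm_e1)
    (by simpa [Quaternion.inner_def, e2_components] using hfK e2 rfl norm_e2)
    (by simpa [Quaternion.inner_def, e3_components] using hfK e3 rfl norm_e3)
    (by simpa [Quaternion.inner_def, e1_components] using hgK e1 rfl norm_e1)
    (by simpa [Quaternion.inner_def, e2_components] using hgK e2 rfl norm_e2)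
    (by simpa [Quaternion.inner_def, e3_components] using hgK e3 rfl norm_e3)
  rw [← hf1, ← hg1] at hsum
  simp only [quatLaplacian, dir2_mul hfq hgq, fueterL]
  rw [sub_eq_add_neg, ← hsum]
  noncomm_ring
end
end
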